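/- (Anti-concentration for weighted sums with lower-bounded mass functions.) Let m ≥ 1, let δ ∈ (0, 1/2], let Y be a random vector in {−1,+1}^m whose probability mass function satisfies P(Y = y) ≥ δ^m for every y ∈ {−1,+1}^m, let w ∈ R^m with |w_i| ≥ α > 0 for all i, and let c ∈ R. Define Z := Σ_i w_i Y_i + c, μ := E[Z], and t := (2δ)^m / 2 (so that 2t = 2^m·δ^m). Then E[ (μ − Z)·1{Z ≤ μ − αt} ] ≥ α·t²/2. -/

import Mathlib

noncomputable section

open Real Finset

/-- The spin value (±1) associated to a Boolean. -/
def spin (b : Bool) : ℝ := if b then 1 else -1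

/-- The energy (Hamiltonian, without normalization) of a configuration of the Ising model:
`Σ_{{i,j}∈E} θ_{ij} x_i x_j + Σ_{i∈V} θ_i x_i`, where the sum over edges is written as half the
sum over ordered adjacent pairs (the edge couplings are symmetric). -/
def energy {p : ℕ} (G : SimpleGraph (Fin p)) [DecidableRel G.Adj]
    (θe : Fin p → Fin p → ℝ) (θv : Fin p → ℝ) (x : Fin p → Bool) : ℝ :=
  (∑ i, ∑ j, if G.Adj i j then θe i j * spin (x i) * spin (x j) else 0) / 2
    + ∑ i, θv i * spin (x i)

/-- The Ising model probability mass function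
`P(x) = exp(Σ_{{i,j}∈E} θ_{ij} x_i x_j + Σ_{i∈V} θ_i x_i − Φ(θ))`. -/
def isingPMF {p : ℕ} (G : SimpleGraph (Fin p)) [DecidableRel G.Adj]
    (θe : Fin p → Fin p → ℝ) (θv : Fin p → ℝ) (x : Fin p → Bool) : ℝ :=
  Real.exp (energy G θe θv x) / ∑ y : Fin p → Bool, Real.exp (energy G θe θv y)

open Classical in
/-- Probability of an event under a pmf on configurations. -/
def prob {p : ℕ} (μ : (Fin p → Bool) → ℝ) (A : (Fin p → Bool) → Prop) : ℝ :=
  ∑ x : Fin p → Bool, if A x then μ x else 0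

/-- Conditional probability `P(A | B)`. -/
def condProb {p : ℕ} (μ : (Fin p → Bool) → ℝ) (A B : (Fin p → Bool) → Prop) : ℝ :=
  prob μ (fun x => A x ∧ B x) / prob μ B

open Classical in
/-- Conditional expectation `E[f(X) | B]`. -/
def condExp {p : ℕ} (μ : (Fin p → Bool) → ℝ) (B : (Fin p → Bool) → Prop)
    (f : (Fin p → Bool) → ℝ) : ℝ :=
  (∑ x : Fin p → Bool, if B x then μ x * f x else 0) / prob μ B

/-- The event `X_S = σ_S` (agreement with `σ` on the set `S`). -/
def agree {p : ℕ} (S : Finset (Fin p)) (σ : Fin p → Bool) (x : Fin p → Bool) : Prop :=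
  ∀ i ∈ S, x i = σ i

/-- The conditional influence
`ν_{u|i;x_S} = P(X_u=+1 | X_i=+1, X_S=x_S) − P(X_u=+1 | X_i=−1, X_S=x_S)`. -/
def condInf {p : ℕ} (μ : (Fin p → Bool) → ℝ) (u i : Fin p) (S : Finset (Fin p))
    (σ : Fin p → Bool) : ℝ :=
  condProb μ (fun x => x u = true) (fun x => x i = true ∧ agree S σ x)
    - condProb μ (fun x => x u = true) (fun x => x i = false ∧ agree S σ x)

/-- The weight `λ_i(x_S) = 2·P(X_i=+1|X_S=x_S)·P(X_i=−1|X_S=x_S)`. -/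
def lamWeight {p : ℕ} (μ : (Fin p → Bool) → ℝ) (i : Fin p) (S : Finset (Fin p))
    (σ : Fin p → Bool) : ℝ :=
  2 * condProb μ (fun x => x i = true) (agree S σ)
    * condProb μ (fun x => x i = false) (agree S σ)

/-- The average conditional influence `ν̄(u,i,S) = E[λ_i(X_S)·|ν_{u|i;X_S}|]`, the expectation
over `X_S` with law the marginal of `μ` on `S` (the integrand depends on the configuration only
through its restriction to `S`). -/
def avgInf {p : ℕ} (μ : (Fin p → Bool) → ℝ) (u i : Fin p) (S : Finset (Fin p)) : ℝ :=
  ∑ x : Fin p → Bool, μ x * (lamWeight μ i S x * |condInf μ u i S x|)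

/-- `δ = (1/2)·e^{−2(βd+h)}`. -/
def deltaLB (β h : ℝ) (d : ℕ) : ℝ := (1/2) * Real.exp (-(2 * (β * d + h)))

/-- `τ* = α²·δ^{4d+1}/(16dβ)`. -/
def tauStar (α β h : ℝ) (d : ℕ) : ℝ :=
  α ^ 2 * (deltaLB β h d) ^ (4 * d + 1) / (16 * d * β)

/-- The conditional mutual information `I(X_u ; X_i | X_S)`, computed with natural logarithms,
written as the expectation of the log-likelihood ratio
`log( P(X_u,X_i,X_S)·P(X_S) / (P(X_u,X_S)·P(X_i,X_S)) )`. -/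
def condMI {p : ℕ} (μ : (Fin p → Bool) → ℝ) (u i : Fin p) (S : Finset (Fin p)) : ℝ :=
  ∑ x : Fin p → Bool, μ x * Real.log
    ((prob μ (fun z => z u = x u ∧ z i = x i ∧ agree S x z) * prob μ (agree S x))
      / (prob μ (fun z => z u = x u ∧ agree S x z)
          * prob μ (fun z => z i = x i ∧ agree S x z)))

/-- Flipping one coordinate of a configuration. -/
def flipAt {m : ℕ} (i : Fin m) (y : Fin m → Bool) : Fin m → Bool :=
  Function.update y i (!y i)

theorem flipAt_involutive {m : ℕ} (i : Fin m) : Function.Involutive (flipAt i) := by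
  intro y
  simp [flipAt]

theorem sum_spin_flipAt {m : ℕ} (w : Fin m → ℝ) (i : Fin m) (y : Fin m → Bool) :
    ∑ j, w j * spin (flipAt i y j) = ∑ j, w j * spin (y j) - 2 * (w i * spin (y i)) := by
  rw [← Finset.add_sum_erase _ _ (mem_univ i),
    ← Finset.add_sum_erase _ (fun j => w j * spin (y j)) (mem_univ i)]
  have h : ∑ j ∈ univ.erase i, w j * spin (flipAt i y j)
      = ∑ j ∈ univ.erase i, w j * spin (y j) := by
    refine Finset.sum_congr rfl fun j hj => ?_
    rw [flipAt, Function.update_of_ne (Finset.ne_of_mem_erase hj)]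
  have hi : spin (flipAt i y i) = -spin (y i) := by
    cases hy : y i <;> simp [flipAt, spin, hy]
  rw [h, hi]
  ring

/-- The truncation `x ↦ x·1{s ≤ x}`, shifted to be nonnegative after subtracting `x / 2`. -/
def shiftedTail (s x : ℝ) : ℝ := x * (if s ≤ x then 1 else 0) - x / 2 + s / 2

theorem shiftedTail_nonneg {s : ℝ} (hs : 0 ≤ s) (x : ℝ) : 0 ≤ shiftedTail s x := by
  unfold shiftedTail
  split_ifs <;> linarith

theorem le_shiftedTail_add {s a : ℝ} (hs : 0 ≤ s) (hsa : s ≤ a) {x x' : ℝ}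
    (h : 2 * a ≤ |x - x'|) : a ≤ shiftedTail s x + shiftedTail s x' := by
  unfold shiftedTail
  rcases le_abs.mp h with h | h <;> split_ifs <;> linarith

/-- anti-concentration for weighted sums with lower-bounded mass functions. -/
theorem stmt9 (m : ℕ) (hm : 1 ≤ m) (δ : ℝ) (hδ0 : 0 < δ) (hδ : δ ≤ 1/2)
    (ρ : (Fin m → Bool) → ℝ) (hρ : ∀ y, δ ^ m ≤ ρ y) (hρsum : ∑ y, ρ y = 1)
    (α : ℝ) (hα : 0 < α) (w : Fin m → ℝ) (hw : ∀ i, α ≤ |w i|) (c : ℝ) :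
    let Z : (Fin m → Bool) → ℝ := fun y => (∑ i, w i * spin (y i)) + c
    let μ : ℝ := ∑ y, ρ y * Z y
    let t : ℝ := (2 * δ) ^ m / 2
    ∑ y, ρ y * ((μ - Z y) * (if Z y ≤ μ - α * t then 1 else 0)) ≥ α * t ^ 2 / 2 := by
  intro Z μ t
  have ht0 : 0 ≤ t := by positivity
  have ht : t ≤ 1 / 2 := by
    have : (2 * δ) ^ m ≤ 1 := pow_le_one₀ (by linarith) (by linarith)
    simp only [t]
    linarith
  have hs0 : 0 ≤ α * t := by positivity
  have hsα : α * t ≤ α := by nlinarith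
  let i : Fin m := ⟨0, hm⟩
  have hpair : ∀ y, α ≤ shiftedTail (α * t) (μ - Z y)
      + shiftedTail (α * t) (μ - Z (flipAt i y)) := by
    intro y
    refine le_shiftedTail_add hs0 hsα ?_
    have hd : μ - Z y - (μ - Z (flipAt i y)) = -(2 * (w i * spin (y i))) := by
      simp only [Z, sum_spin_flipAt]
      ring
    have hspin : |spin (y i)| = 1 := by cases y i <;> simp [spin]
    rw [hd, abs_neg, abs_mul, abs_mul, hspin, abs_two]
    linarith [hw i]
  have hunif : 2 ^ m * α ≤ 2 * ∑ y, shiftedTail (α * t) (μ - Z y) := by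
    have hflip : ∑ y, shiftedTail (α * t) (μ - Z (flipAt i y))
        = ∑ y, shiftedTail (α * t) (μ - Z y) :=
      Equiv.sum_comp (flipAt_involutive i).toPerm (fun y => shiftedTail (α * t) (μ - Z y))
    calc 2 ^ m * α = ∑ _y : Fin m → Bool, α := by simp
      _ ≤ ∑ y, (shiftedTail (α * t) (μ - Z y) + shiftedTail (α * t) (μ - Z (flipAt i y))) :=
        Finset.sum_le_sum fun y _ => hpair y
      _ = _ := by rw [Finset.sum_add_distrib, hflip]; ring
  have hmass : δ ^ m * ∑ y, shiftedTail (α * t) (μ - Z y)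
      ≤ ∑ y, ρ y * shiftedTail (α * t) (μ - Z y) := by
    rw [Finset.mul_sum]
    exact Finset.sum_le_sum fun y _ =>
      mul_le_mul_of_nonneg_right (hρ y) (shiftedTail_nonneg hs0 _)
  have hcenter : ∑ y, ρ y * (μ - Z y) = 0 := by
    simp only [mul_sub, Finset.sum_sub_distrib, ← Finset.sum_mul, hρsum]
    simp [μ]
  have hexp : ∑ y, ρ y * shiftedTail (α * t) (μ - Z y)
      = ∑ y, ρ y * ((μ - Z y) * (if Z y ≤ μ - α * t then 1 else 0)) + α * t / 2 := by
    have hsplit : ∀ y, ρ y * shiftedTail (α * t) (μ - Z y)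
        = ρ y * ((μ - Z y) * (if Z y ≤ μ - α * t then 1 else 0))
          - ρ y * (μ - Z y) / 2 + ρ y * (α * t / 2) := by
      intro y
      simp only [shiftedTail, le_sub_comm (a := α * t)]
      ring
    simp only [hsplit, Finset.sum_add_distrib, Finset.sum_sub_distrib, ← Finset.sum_div,
      ← Finset.sum_mul, hcenter, hρsum]
    ring
  have hδm : δ ^ m * 2 ^ m = 2 * t := by
    simp only [t, mul_pow]
    ring
  have hlow : α * t ≤ δ ^ m * ∑ y, shiftedTail (α * t) (μ - Z y) := by
    have h := mul_le_mul_of_nonneg_left hunif (pow_nonneg hδ0.le m)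
    rw [← mul_assoc, hδm] at h
    linarith
  nlinarith
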